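/- For every natural number n ≥ 1 and every element u of a commutative ring (e.g., every real number u), Σ_{F ∈ F_n} u^{lead(F)} = u · Π_{i=1}^{n−1} (i + (n−i+1)·u). -/

import Mathlib

/-!  Parking functions and the parking algorithm. -/

/-- Parking algorithm: cars `0, 1, ..., n-1` (in Lean's 0-based indexing of `Fin n`,
representing cars `1, ..., n`) arrive in order; car `i` drives to its favorite
(1-indexed) space `p i` and parks in the first space `s ≥ p i` not occupied by an
earlier car.  `PA p i` is the space where car `i` actually parks. -/
noncomputable def PA {n : ℕ} (p : Fin n → ℕ) (i : Fin n) : ℕ :=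
  sInf {s : ℕ | p i ≤ s ∧ ∀ j : Fin n, j < i → PA p j ≠ s}
termination_by i.val
decreasing_by exact ‹_ < _›

/-- `p` is a parking function of length `n`: every favorite space is in `{1, ..., n}`
and every car ends up parked in a space `≤ n`. -/
def IsParkingFunction {n : ℕ} (p : Fin n → ℕ) : Prop :=
  (∀ i, 1 ≤ p i ∧ p i ≤ n) ∧ ∀ i, PA p i ≤ n

/-- The set (type) `PF_n` of parking functions of length `n`. -/
def ParkingFunction (n : ℕ) : Type :=
  {p : Fin n → ℕ // IsParkingFunction p}

instance {n : ℕ} : Finite (ParkingFunction n) := by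
  apply Finite.of_injective
    (fun P : ParkingFunction n => fun i => (⟨P.1 i, Nat.lt_succ_of_le (P.2.1 i).2⟩ : Fin (n+1)))
  intro P Q h
  apply Subtype.ext; funext i
  simpa [Fin.mk.injEq] using congrFun h i

noncomputable instance {n : ℕ} : Fintype (ParkingFunction n) := Fintype.ofFinite _

/-- `jumpAt p c` is the number of jumps of car `c`, i.e. `q_c - p_c`. -/
noncomputable def jumpAt {n : ℕ} (p : Fin n → ℕ) (c : Fin n) : ℕ := PA p c - p c

/-- `jump p` is the total number of jumps. -/
noncomputable def jump {n : ℕ} (p : Fin n → ℕ) : ℕ := ∑ c, jumpAt p c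

/-- `luckyCount p k` is the number of cars `c` with `jump(p : c) = k`. -/
noncomputable def luckyCount {n : ℕ} (p : Fin n → ℕ) (k : ℕ) : ℕ :=
  Set.ncard {c : Fin n | jumpAt p c = k}

/-- `lucky p` is the number of lucky cars, i.e. cars with no jumps. -/
noncomputable def lucky {n : ℕ} (p : Fin n → ℕ) : ℕ :=
  Set.ncard {c : Fin n | jumpAt p c = 0}

/-- Car `c` is critical: immediately after car `c` is parked, there is no empty space
among the spaces strictly to the right of its space `q_c` within `{1, ..., n}`. -/
def IsCritical {n : ℕ} (p : Fin n → ℕ) (c : Fin n) : Prop :=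
  ∀ s : ℕ, PA p c < s → s ≤ n → ∃ j : Fin n, j ≤ c ∧ PA p j = s

/-- `critic p` is the number of critical cars. -/
noncomputable def critic {n : ℕ} (p : Fin n → ℕ) : ℕ :=
  Set.ncard {c : Fin n | IsCritical p c}

/-!  Rooted labeled forests, encoded by their parent function. -/

/-- A parent function `par : Fin n → Option (Fin n)` (where `par v = none` means that
`v` is a root) encodes a rooted labeled forest on `n` vertices iff it has no cycles. -/
def IsForest {n : ℕ} (par : Fin n → Option (Fin n)) : Prop :=
  ∀ v : Fin n, ¬ Relation.TransGen (fun a b => par a = some b) v v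

/-- The set (type) `F_n` of rooted labeled forests on `n` vertices. -/
def Forest (n : ℕ) : Type := {par : Fin n → Option (Fin n) // IsForest par}

instance {n : ℕ} : Finite (Forest n) := Subtype.finite
noncomputable instance {n : ℕ} : Fintype (Forest n) := Fintype.ofFinite _

/-- `x` is a descendant of `v`: `v` lies on the (unique) path from the root of `x`'s
component to `x`, i.e. the ancestor chain of `x` reaches `v`. -/
def Descendant {n : ℕ} (par : Fin n → Option (Fin n)) (v x : Fin n) : Prop :=
  Relation.ReflTransGen (fun a b => par a = some b) x v

/-- `forestInvAt F v = inv(F : v)`, the number of pairs `(v, x)` with `v > x` and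
`x` a descendant of `v`. -/
noncomputable def forestInvAt {n : ℕ} (F : Forest n) (v : Fin n) : ℕ :=
  Set.ncard {x : Fin n | x < v ∧ Descendant F.1 v x}

/-- `forestInv F = inv(F)`, the total number of inversions of `F`. -/
noncomputable def forestInv {n : ℕ} (F : Forest n) : ℕ := ∑ v, forestInvAt F v

/-- `forestLeadCount F k` is the number of vertices `v` with `inv(F : v) = k`. -/
noncomputable def forestLeadCount {n : ℕ} (F : Forest n) (k : ℕ) : ℕ :=
  Set.ncard {v : Fin n | forestInvAt F v = k}

/-- `forestLead F = lead(F)`, the number of leaders of `F`. -/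
noncomputable def forestLead {n : ℕ} (F : Forest n) : ℕ :=
  Set.ncard {v : Fin n | forestInvAt F v = 0}

/-- `forestTree F = tree(F)`, the number of trees (connected components) of `F`,
i.e. the number of roots. -/
noncomputable def forestTree {n : ℕ} (F : Forest n) : ℕ :=
  Set.ncard {v : Fin n | F.1 v = none}

open Finset Relation

section Convolution

variable {R : Type*} [CommRing R] (z a : R)

/-- The Gould-type product `∏_{i < n} (y + n z + i a)`. -/
def gouldProd (n : ℕ) (y : R) : R := ∏ i ∈ range n, (y + n * z + i * a)

/-- The Rothe–Hagen product `x ∏_{1 ≤ i < n} (x + n z + i a)`, equal to `1` for `n = 0`. -/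
def hagenProd : ℕ → R → R
  | 0, _ => 1
  | n + 1, x => x * gouldProd z a n (x + z + a)

lemma gouldProd_succ (n : ℕ) (y : R) :
    gouldProd z a (n + 1) y = (y + (n + 1) * z) * gouldProd z a n (y + z + a) := by
  rw [gouldProd, prod_range_succ', mul_comm, gouldProd]
  congr 1
  · push_cast; ring
  · refine prod_congr rfl fun i _ => ?_
    push_cast; ring

lemma gouldProd_eq_hagenProd_add (n : ℕ) (x : R) :
    gouldProd z a n x = hagenProd z a n x + n * z * gouldProd z a (n - 1) (x + z + a) := by
  cases n with
  | zero => simp [gouldProd, hagenProd]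
  | succ n =>
    rw [gouldProd_succ, hagenProd, Nat.add_sub_cancel]
    push_cast
    ring

lemma sum_antidiagonal_choose_mul_fst (m : ℕ) (f : ℕ → ℕ → R) :
    ∑ ij ∈ antidiagonal (m + 1), ((m + 1).choose ij.1 : R) * (ij.1 * f ij.1 ij.2)
      = (m + 1) * ∑ ij ∈ antidiagonal m, (m.choose ij.1 : R) * f (ij.1 + 1) ij.2 := by
  rw [Finset.Nat.antidiagonal_succ, sum_cons, sum_map, mul_sum]
  simp only [Nat.cast_zero, zero_mul, mul_zero, zero_add]
  refine sum_congr rfl fun ij _ => ?_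
  have h := congrArg (Nat.cast : ℕ → R) (Nat.add_one_mul_choose_eq m ij.1)
  push_cast at h
  simp only [Function.Embedding.prodMap, Function.Embedding.coeFn_mk, Prod.map,
    Nat.succ_eq_add_one, Function.Embedding.refl_apply]
  push_cast
  linear_combination (-f (ij.1 + 1) ij.2) * h

/-- The binomial convolution of `hagenProd` and `gouldProd`. -/
def hagenGouldConv (n : ℕ) (x y : R) : R :=
  ∑ ij ∈ antidiagonal n, (n.choose ij.1 : R) * (hagenProd z a ij.1 x * gouldProd z a ij.2 y)

/-- The binomial convolution of `gouldProd` with itself. -/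
def gouldConv (n : ℕ) (x y : R) : R :=
  ∑ ij ∈ antidiagonal n, (n.choose ij.1 : R) * (gouldProd z a ij.1 x * gouldProd z a ij.2 y)

lemma gouldConv_eq (n : ℕ) (x y : R) :
    gouldConv z a n x y
      = hagenGouldConv z a n x y + n * z * gouldConv z a (n - 1) (x + z + a) y := by
  cases n with
  | zero => simp [gouldConv, hagenGouldConv, gouldProd, hagenProd]
  | succ m =>
    have h := sum_antidiagonal_choose_mul_fst m
      (fun i j => z * gouldProd z a (i - 1) (x + z + a) * gouldProd z a j y)
    simp only [Nat.add_sub_cancel] at h ⊢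
    have h₁ : gouldConv z a (m + 1) x y = hagenGouldConv z a (m + 1) x y
        + ∑ ij ∈ antidiagonal (m + 1), ((m + 1).choose ij.1 : R) *
          (ij.1 * (z * gouldProd z a (ij.1 - 1) (x + z + a) * gouldProd z a ij.2 y)) := by
      rw [gouldConv, hagenGouldConv, ← sum_add_distrib]
      refine sum_congr rfl fun ij _ => ?_
      rw [gouldProd_eq_hagenProd_add z a ij.1 x]
      ring
    rw [h₁, h, gouldConv]
    simp only [mul_sum]
    push_cast
    congr 1
    refine sum_congr rfl fun ij _ => ?_
    ring

lemma hagenGouldConv_succ (m : ℕ) (x y : R) :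
    hagenGouldConv z a (m + 1) x y
      = x * gouldConv z a m (x + z + a) y
        + (y + (m + 1) * z) * hagenGouldConv z a m x (y + z + a)
        - m * z * x * gouldConv z a (m - 1) (x + z + a) (y + z + a) := by
  have h₁ : ∑ ij ∈ antidiagonal m, (m.choose ij.1 : R) *
        (hagenProd z a ij.1 x * gouldProd z a (ij.2 + 1) y)
      = (y + (m + 1) * z) * hagenGouldConv z a m x (y + z + a)
        - z * ∑ ij ∈ antidiagonal m, (m.choose ij.1 : R) *
          (ij.1 * (hagenProd z a ij.1 x * gouldProd z a ij.2 (y + z + a))) := by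
    rw [hagenGouldConv, mul_sum, mul_sum, ← sum_sub_distrib]
    refine sum_congr rfl fun ij hij => ?_
    have h := congrArg (Nat.cast : ℕ → R) (mem_antidiagonal.mp hij)
    push_cast at h
    rw [gouldProd_succ, ← h]
    ring
  have h₂ : ∑ ij ∈ antidiagonal m, (m.choose ij.1 : R) *
        (ij.1 * (hagenProd z a ij.1 x * gouldProd z a ij.2 (y + z + a)))
      = m * x * gouldConv z a (m - 1) (x + z + a) (y + z + a) := by
    cases m with
    | zero => simp
    | succ k =>
      rw [sum_antidiagonal_choose_mul_fst k
        (fun i j => hagenProd z a i x * gouldProd z a j (y + z + a)), gouldConv]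
      simp only [Nat.add_sub_cancel, hagenProd, mul_sum]
      push_cast
      refine sum_congr rfl fun ij _ => ?_
      ring
  have h₃ : ∑ ij ∈ antidiagonal m, (m.choose ij.2 : R) *
        (hagenProd z a (ij.1 + 1) x * gouldProd z a ij.2 y)
      = x * gouldConv z a m (x + z + a) y := by
    rw [gouldConv, mul_sum]
    refine sum_congr rfl fun ij hij => ?_
    rw [← Nat.choose_symm_of_eq_add (mem_antidiagonal.mp hij).symm, hagenProd]
    ring
  rw [hagenGouldConv, sum_antidiagonal_choose_succ_mul
    (fun i j => hagenProd z a i x * gouldProd z a j y), h₁, h₂, h₃]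
  ring

lemma hagenGouldConv_and_gouldConv (n : ℕ) :
    (∀ x y : R, hagenGouldConv z a n x y = gouldProd z a n (x + y)) ∧
      ∀ x y x' y' : R, x + y = x' + y' → gouldConv z a n x y = gouldConv z a n x' y' := by
  induction n using Nat.strong_induction_on with
  | _ n ih =>
    have hH : ∀ x y : R, hagenGouldConv z a n x y = gouldProd z a n (x + y) := by
      cases n with
      | zero => simp [hagenGouldConv, hagenProd, gouldProd]
      | succ m =>
        intro x y
        have h₁ := (ih m (by omega)).1
        have h₂ : (m : R) * gouldConv z a (m - 1) (x + z + a + z + a) y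
            = m * gouldConv z a (m - 1) (x + z + a) (y + z + a) := by
          cases m with
          | zero => simp
          | succ k => rw [(ih (k + 1 - 1) (by omega)).2 _ _ (x + z + a) (y + z + a) (by ring)]
        rw [hagenGouldConv_succ, gouldConv_eq, h₁, h₁, gouldProd_succ,
          show x + z + a + y = x + y + z + a by ring,
          show x + (y + z + a) = x + y + z + a by ring]
        linear_combination x * z * h₂
    refine ⟨hH, fun x y x' y' hxy => ?_⟩
    rw [gouldConv_eq, gouldConv_eq z a n x' y', hH, hH, hxy]
    cases n with
    | zero => simp
    | succ m =>
      rw [(ih (m + 1 - 1) (by omega)).2 (x + z + a) y (x' + z + a) y'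
        (by linear_combination hxy)]

/-- The Rothe–Hagen convolution identity. -/
lemma hagenGouldConv_eq (n : ℕ) (x y : R) :
    hagenGouldConv z a n x y = gouldProd z a n (x + y) :=
  (hagenGouldConv_and_gouldConv z a n).1 x y

lemma add_mul_hagenProd (u : R) (j : ℕ) :
    (u + j) * hagenProd u (1 - u) j u = u * gouldProd u (1 - u) j 1 := by
  cases j with
  | zero => simp [hagenProd, gouldProd]
  | succ j =>
    have h : gouldProd u (1 - u) (j + 1) 1
        = gouldProd u (1 - u) j (u + u + (1 - u)) * (u + (j + 1)) := by
      rw [gouldProd, prod_range_succ, gouldProd]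
      congr 1
      · refine prod_congr rfl fun i _ => ?_
        push_cast; ring
      · push_cast; ring
    rw [h, hagenProd]
    push_cast; ring

/-- The quadratic recurrence of the numbers `hagenProd u (1 - u) n u`. -/
lemma hagenProd_recurrence (u : R) (n : ℕ) :
    ∑ j ∈ range (n + 1), (n.choose j : R) *
        ((u + j) * hagenProd u (1 - u) j u * hagenProd u (1 - u) (n - j) u)
      = hagenProd u (1 - u) (n + 1) u := by
  rw [hagenProd, show u + u + (1 - u) = u + 1 by ring, ← hagenGouldConv_eq, hagenGouldConv,
    ← Finset.Nat.sum_antidiagonal_eq_sum_range_succ (fun i j => (n.choose i : R) *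
      ((u + i) * hagenProd u (1 - u) i u * hagenProd u (1 - u) j u)),
    ← Finset.Nat.sum_antidiagonal_swap, mul_sum]
  refine sum_congr rfl fun ij hij => ?_
  rw [add_mul_hagenProd, Prod.fst_swap, Prod.snd_swap,
    ← Nat.choose_symm_of_eq_add (mem_antidiagonal.mp hij).symm]
  ring

lemma hagenProd_eq_mul_prod (u : R) (n : ℕ) :
    hagenProd u (1 - u) (n + 1) u
      = u * ∏ i ∈ Icc 1 n, ((i : R) + ((n + 1 - i + 1 : ℕ) : R) * u) := by
  rw [hagenProd, gouldProd, ← Finset.Ico_add_one_right_eq_Icc, prod_Ico_eq_prod_range]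
  congr 1
  refine prod_congr rfl fun i hi => ?_
  have hi : i ≤ n := by simp at hi; omega
  rw [show n + 1 - (1 + i) + 1 = n - i + 1 by omega]
  push_cast [hi]
  ring

end Convolution

section ParentFunctions

variable {V : Type*}

/-- The step relation of a parent function. -/
def ParentStep (p : V → Option V) (x y : V) : Prop := p x = some y

lemma transGen_iff_of_mem {r s : V → V → Prop} {T : Set V}
    (h : ∀ x y, y ∈ T → (r x y ↔ s x y)) (hT : ∀ x y, r x y → y ∈ T → x ∈ T)
    {x v : V} (hv : v ∈ T) : TransGen r x v ↔ TransGen s x v := by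
  constructor
  · intro hx
    have : x ∈ T ∧ TransGen s x v := by
      induction hx using TransGen.head_induction_on with
      | single hxv => exact ⟨hT _ _ hxv hv, .single ((h _ _ hv).1 hxv)⟩
      | head hxy _ ih => exact ⟨hT _ _ hxy ih.1, .head ((h _ _ ih.1).1 hxy) ih.2⟩
    exact this.2
  · intro hx
    have : x ∈ T ∧ TransGen r x v := by
      induction hx using TransGen.head_induction_on with
      | single hxv =>
        have hr := (h _ _ hv).2 hxv
        exact ⟨hT _ _ hr hv, .single hr⟩
      | head hxy _ ih =>
        have hr := (h _ _ ih.1).2 hxy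
        exact ⟨hT _ _ hr ih.1, .head hr ih.2⟩
    exact this.2

lemma eq_of_reflTransGen_of_eq_none {p : V → Option V} {r v : V} (hr : p r = none)
    (h : ReflTransGen (ParentStep p) r v) : v = r := by
  rcases h.cases_head with h | ⟨c, hc, _⟩
  · exact h.symm
  · simp [ParentStep, hr] at hc

lemma root_unique {p : V → Option V} {x r r' : V} (hr : p r = none) (hr' : p r' = none)
    (h : ReflTransGen (ParentStep p) x r) (h' : ReflTransGen (ParentStep p) x r') : r = r' := by
  have hu : Relator.RightUnique (ParentStep p) := fun a b c hb hc =>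
    Option.some_injective _ (hb.symm.trans hc)
  rcases ReflTransGen.total_of_right_unique hu h' h with h | h
  · exact eq_of_reflTransGen_of_eq_none hr' h
  · exact (eq_of_reflTransGen_of_eq_none hr h).symm

/-- A parent function without cycles. -/
def AcyclicParent (p : V → Option V) : Prop := ∀ v, ¬ TransGen (ParentStep p) v v

lemma AcyclicParent.wellFounded [Finite V] {p : V → Option V} (hp : AcyclicParent p) :
    WellFounded fun y x => ParentStep p x y := by
  have : Std.Irrefl (TransGen fun y x => ParentStep p x y) :=
    ⟨fun v hv => hp v (transGen_swap.1 hv)⟩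
  exact (Finite.wellFounded_of_trans_of_irrefl
    (TransGen fun y x => ParentStep p x y)).mono fun _ _ h => .single h

lemma AcyclicParent.exists_root [Finite V] {p : V → Option V} (hp : AcyclicParent p) (x : V) :
    ∃ r, p r = none ∧ ReflTransGen (ParentStep p) x r := by
  induction x using hp.wellFounded.induction with
  | _ x ih =>
    cases hx : p x with
    | none => exact ⟨x, hx, .refl⟩
    | some y =>
      obtain ⟨r, hr, h⟩ := ih y hx
      exact ⟨r, hr, .head hx h⟩

open Classical in
/-- The forests with vertex set `S`, as parent functions which are trivial off `S`. -/
noncomputable def forestsOn [Fintype V] (S : Finset V) : Finset (V → Option V) :=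
  {p | AcyclicParent p ∧ ∀ x y, p x = some y → x ∈ S ∧ y ∈ S}

lemma mem_forestsOn [Fintype V] {S : Finset V} {p : V → Option V} :
    p ∈ forestsOn S ↔ AcyclicParent p ∧ ∀ x y, p x = some y → x ∈ S ∧ y ∈ S := by
  simp [forestsOn]

open Classical in
/-- Join the roots of `p` in `B` to the new root `r`, and use `q` off `B`. -/
noncomputable def graft (B : Finset V) (r : V) (p q : V → Option V) (x : V) : Option V :=
  if x = r then none else if x ∈ B then some ((p x).getD r) else q x

lemma graft_root {B : Finset V} {r : V} {p q : V → Option V} : graft B r p q r = none := by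
  simp [graft]

section Graft

variable [Fintype V] [DecidableEq V] {S B : Finset V} {r : V} {p q : V → Option V}

lemma graft_mem_iff (hr : r ∈ B) (hp : p ∈ forestsOn (B.erase r)) (hq : q ∈ forestsOn (S \ B))
    {x y : V} (h : graft B r p q x = some y) : x ∈ B ↔ y ∈ B := by
  rw [mem_forestsOn] at hp hq
  unfold graft at h
  split_ifs at h with h₁ h₂
  · cases hx : p x with
    | none => simp_all
    | some w =>
      have := hp.2 _ _ hx
      simp_all
  · have := hq.2 _ _ h
    simp_all

lemma graft_reflTransGen_root (hp : p ∈ forestsOn (B.erase r)) {x : V} (hx : x ∈ B) :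
    ReflTransGen (ParentStep (graft B r p q)) x r := by
  rw [mem_forestsOn] at hp
  induction x using hp.1.wellFounded.induction with
  | _ x ih =>
    by_cases hxr : x = r
    · rw [hxr]
    · cases h : p x with
      | none => exact .single (by simp [ParentStep, graft, hxr, hx, h])
      | some y =>
        exact .head (by simp [ParentStep, graft, hxr, hx, h])
          (ih y h (mem_of_mem_erase (hp.2 _ _ h).2))

lemma graft_reflTransGen_root_iff (hr : r ∈ B) (hp : p ∈ forestsOn (B.erase r))
    (hq : q ∈ forestsOn (S \ B)) {x : V} :
    ReflTransGen (ParentStep (graft B r p q)) x r ↔ x ∈ B := by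
  refine ⟨fun h => ?_, graft_reflTransGen_root hp⟩
  induction h using ReflTransGen.head_induction_on with
  | refl => exact hr
  | head h _ ih => exact (graft_mem_iff hr hp hq h).2 ih

lemma graft_transGen_iff_left (hr : r ∈ B) (hp : p ∈ forestsOn (B.erase r))
    (hq : q ∈ forestsOn (S \ B)) {x v : V} (hv : v ∈ B.erase r) :
    TransGen (ParentStep (graft B r p q)) x v ↔ TransGen (ParentStep p) x v := by
  refine transGen_iff_of_mem (T := (B.erase r : Finset V)) (fun x y hy => ?_)
    (fun x y h hy => ?_) hv
  · have hy' : y ≠ r ∧ y ∈ B := mem_erase.1 hy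
    constructor
    · intro h
      have hxB := (graft_mem_iff hr hp hq h).2 hy'.2
      unfold ParentStep graft at h
      split_ifs at h with h₁
      cases hx : p x with
      | none => simp_all
      | some w => simpa [ParentStep, hx] using h
    · intro h
      have := ((mem_forestsOn.1 hp).2 _ _ h).1
      unfold ParentStep at h
      simp_all [ParentStep, graft]
  · have hxB := (graft_mem_iff hr hp hq h).2 (mem_of_mem_erase hy)
    have : x ≠ r := by
      rintro rfl
      simp [ParentStep, graft] at h
    simp [this, hxB]

lemma graft_transGen_iff_right (hr : r ∈ B) (hp : p ∈ forestsOn (B.erase r))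
    (hq : q ∈ forestsOn (S \ B)) {x v : V} (hv : v ∉ B) :
    TransGen (ParentStep (graft B r p q)) x v ↔ TransGen (ParentStep q) x v := by
  refine transGen_iff_of_mem (T := {x | x ∉ B}) (fun x y hy => ?_)
    (fun x y h hy => (graft_mem_iff hr hp hq h).not.2 hy) hv
  constructor
  · intro h
    have hxB := (graft_mem_iff hr hp hq h).not.2 hy
    have hxr : x ≠ r := fun h => hxB (h ▸ hr)
    simpa [ParentStep, graft, hxr, hxB] using h
  · intro h
    have hxB := (mem_sdiff.1 ((mem_forestsOn.1 hq).2 _ _ h).1).2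
    have hxr : x ≠ r := fun h => hxB (h ▸ hr)
    simpa [ParentStep, graft, hxr, hxB] using h

lemma graft_mem_forestsOn (hB : B ⊆ S) (hr : r ∈ B) (hp : p ∈ forestsOn (B.erase r))
    (hq : q ∈ forestsOn (S \ B)) : graft B r p q ∈ forestsOn S := by
  refine mem_forestsOn.2 ⟨fun v hv => ?_, fun x y h => ?_⟩
  · by_cases hvB : v ∈ B
    · by_cases hvr : v = r
      · obtain ⟨c, hc, -⟩ := TransGen.head'_iff.1 hv
        simp [ParentStep, graft, hvr] at hc
      · exact (mem_forestsOn.1 hp).1 v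
          ((graft_transGen_iff_left hr hp hq (mem_erase.2 ⟨hvr, hvB⟩)).1 hv)
    · exact (mem_forestsOn.1 hq).1 v ((graft_transGen_iff_right hr hp hq hvB).1 hv)
  · have hxy := graft_mem_iff hr hp hq h
    by_cases hx : x ∈ B
    · exact ⟨hB hx, hB (hxy.1 hx)⟩
    · have hxr : x ≠ r := fun h => hx (h ▸ hr)
      have hqx : q x = some y := by simpa [graft, hxr, hx] using h
      have := (mem_forestsOn.1 hq).2 _ _ hqx
      exact ⟨sdiff_subset this.1, sdiff_subset this.2⟩

lemma graft_injective {B' : Finset V} {r' a : V} {p' q' : V → Option V}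
    (ha : a ∈ B) (ha' : a ∈ B') (hr : r ∈ B) (hr' : r' ∈ B')
    (hp : p ∈ forestsOn (B.erase r)) (hp' : p' ∈ forestsOn (B'.erase r'))
    (hq : q ∈ forestsOn (S \ B)) (hq' : q' ∈ forestsOn (S \ B'))
    (h : graft B r p q = graft B' r' p' q') : B = B' ∧ r = r' ∧ p = p' ∧ q = q' := by
  have hrr : r = r' := by
    refine root_unique (p := graft B r p q) graft_root (by rw [h, graft_root])
      (graft_reflTransGen_root hp ha) ?_
    rw [h]
    exact graft_reflTransGen_root hp' ha'
  subst hrr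
  have hBB : B = B' := by
    ext x
    rw [← graft_reflTransGen_root_iff hr hp hq, ← graft_reflTransGen_root_iff hr' hp' hq', h]
  subst hBB
  have none_of_notMem {T : Finset V} {f : V → Option V} (hf : f ∈ forestsOn T) {x : V}
      (hx : x ∉ T) : f x = none :=
    Option.eq_none_iff_forall_ne_some.2 fun y hy => hx ((mem_forestsOn.1 hf).2 _ _ hy).1
  have ne_root {f : V → Option V} (hf : f ∈ forestsOn (B.erase r)) (x : V) : f x ≠ some r :=
    fun hx => by simpa using ((mem_forestsOn.1 hf).2 _ _ hx).2
  refine ⟨rfl, rfl, funext fun x => ?_, funext fun x => ?_⟩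
  · by_cases hx : x ∈ B.erase r
    · have hx' := mem_erase.1 hx
      have hgx := congrFun h x
      have h₁ := ne_root hp x
      have h₂ := ne_root hp' x
      simp only [graft, hx'.1, hx'.2, if_true, if_false] at hgx
      cases hpx : p x <;> cases hpx' : p' x <;> simp_all
    · rw [none_of_notMem hp hx, none_of_notMem hp' hx]
  · by_cases hx : x ∈ B
    · rw [none_of_notMem hq (by simp [hx]), none_of_notMem hq' (by simp [hx])]
    · have hxr : x ≠ r := fun h => hx (h ▸ hr)
      simpa [graft, hxr, hx] using congrFun h x

lemma exists_graft_eq {f : V → Option V} (hf : f ∈ forestsOn S) {a : V} (ha : a ∈ S) :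
    ∃ B ⊆ S, a ∈ B ∧ ∃ r ∈ B, ∃ p ∈ forestsOn (B.erase r), ∃ q ∈ forestsOn (S \ B),
      graft B r p q = f := by
  classical
  have hf' := mem_forestsOn.1 hf
  obtain ⟨r, hr, har⟩ := hf'.1.exists_root a
  have step {x y : V} (hx : f x = some y) (hxr : ReflTransGen (ParentStep f) x r) :
      ReflTransGen (ParentStep f) y r := by
    rcases hxr.cases_head with h | ⟨c, hc, h⟩
    · simp_all
    · rwa [← Option.some_injective _ (hc.symm.trans hx)]
  have hrS : r ∈ S := by
    rcases har.cases_tail with h | ⟨c, -, hc⟩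
    · rwa [h]
    · exact (hf'.2 _ _ hc).2
  set B : Finset V := {x ∈ S | ReflTransGen (ParentStep f) x r} with hB
  have hmem {x : V} : x ∈ B ↔ x ∈ S ∧ ReflTransGen (ParentStep f) x r := by simp [hB]
  have hrB : r ∈ B := hmem.2 ⟨hrS, .refl⟩
  refine ⟨B, filter_subset _ _, hmem.2 ⟨ha, har⟩, r, hrB,
    fun x => if x ∈ B ∧ f x ≠ some r then f x else none, mem_forestsOn.2 ⟨?_, ?_⟩,
    fun x => if x ∈ B then none else f x, mem_forestsOn.2 ⟨?_, ?_⟩, ?_⟩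
  · refine fun v hv => hf'.1 v (TransGen.mono (fun x y h => ?_) _ _ hv)
    simp only [ParentStep] at h ⊢
    split_ifs at h
    exact h
  · intro x y h
    split_ifs at h with h₁
    have hx := hmem.1 h₁.1
    have hxr : x ≠ r := by rintro rfl; simp_all
    have hyr : y ≠ r := by rintro rfl; exact h₁.2 h
    exact ⟨mem_erase.2 ⟨hxr, h₁.1⟩,
      mem_erase.2 ⟨hyr, hmem.2 ⟨(hf'.2 _ _ h).2, step h hx.2⟩⟩⟩
  · refine fun v hv => hf'.1 v (TransGen.mono (fun x y h => ?_) _ _ hv)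
    simp only [ParentStep] at h ⊢
    split_ifs at h
    exact h
  · intro x y h
    split_ifs at h with h₁
    have hxy := hf'.2 _ _ h
    refine ⟨mem_sdiff.2 ⟨hxy.1, h₁⟩, mem_sdiff.2 ⟨hxy.2, fun hy => h₁ ?_⟩⟩
    exact hmem.2 ⟨hxy.1, .head h (hmem.1 hy).2⟩
  · funext x
    by_cases hxr : x = r
    · simp [graft, hxr, hr]
    by_cases hx : x ∈ B
    · cases hfx : f x with
      | none => exact absurd (eq_of_reflTransGen_of_eq_none hfx (hmem.1 hx).2).symm hxr
      | some y => by_cases hy : y = r <;> simp [graft, hxr, hx, hfx, hy]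
    · simp [graft, hxr, hx]

end Graft

lemma sum_powerset_filter_mem [DecidableEq V] {M : Type*} [AddCommMonoid M] {S : Finset V} {a : V}
    (ha : a ∈ S) (g : ℕ → M) :
    ∑ B ∈ S.powerset with a ∈ B, g (#B)
      = ∑ j ∈ range (#S), (#S - 1).choose j • g (j + 1) := by
  have hcard : #(S.erase a) + 1 = #S := card_erase_add_one ha
  have h := sum_powerset_apply_card (fun j => g (j + 1)) (x := S.erase a)
  rw [hcard, card_erase_of_mem ha] at h
  rw [← h]
  refine sum_nbij' (fun B => B.erase a) (fun T => insert a T) ?_ ?_ ?_ ?_ ?_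
  · intro B hB
    simp only [mem_filter, mem_powerset] at hB ⊢
    exact erase_subset_erase a hB.1
  · intro T hT
    simp only [mem_filter, mem_powerset] at hT ⊢
    exact ⟨insert_subset ha (hT.trans (erase_subset _ _)), mem_insert_self _ _⟩
  · intro B hB
    exact insert_erase (mem_filter.1 hB).2
  · intro T hT
    exact erase_insert fun h => by simpa using mem_powerset.1 hT h
  · intro B hB
    rw [card_erase_add_one (mem_filter.1 hB).2]

section Leaders

variable [LinearOrder V]

/-- The vertex `v` is at most each of its descendants. -/
def IsLeader (p : V → Option V) (v : V) : Prop := ∀ x, ReflTransGen (ParentStep p) x v → v ≤ x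

lemma isLeader_congr {p q : V → Option V} {v : V}
    (h : ∀ x, TransGen (ParentStep p) x v ↔ TransGen (ParentStep q) x v) :
    IsLeader p v ↔ IsLeader q v := by
  simp only [IsLeader, reflTransGen_iff_eq_or_transGen, h]

variable {R : Type*} [CommRing R] (u : R)

open Classical in
/-- The weight `u ^ lead` of a forest with vertex set `S`. -/
noncomputable def leadWeight (S : Finset V) (p : V → Option V) : R :=
  ∏ v ∈ S, if IsLeader p v then u else 1

variable [Fintype V]

lemma leadWeight_graft {S B : Finset V} {r : V} {p q : V → Option V} (hB : B ⊆ S) (hr : r ∈ B)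
    (hp : p ∈ forestsOn (B.erase r)) (hq : q ∈ forestsOn (S \ B)) :
    leadWeight u S (graft B r p q)
      = (if ∀ x ∈ B, r ≤ x then u else 1)
        * (leadWeight u (B.erase r) p * leadWeight u (S \ B) q) := by
  classical
  unfold leadWeight
  rw [← prod_sdiff hB, mul_comm, ← mul_prod_erase B _ hr, mul_assoc]
  congr 1
  · simp only [IsLeader, graft_reflTransGen_root_iff hr hp hq]
  congr 1
  · refine prod_congr rfl fun v hv => ?_
    simp only [isLeader_congr fun x => graft_transGen_iff_left (x := x) hr hp hq hv]
  · refine prod_congr rfl fun v hv => ?_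
    simp only [isLeader_congr fun x =>
      graft_transGen_iff_right (x := x) hr hp hq (mem_sdiff.1 hv).2]

lemma sum_ite_isLeast {B : Finset V} (hB : B.Nonempty) :
    ∑ r ∈ B, (if ∀ x ∈ B, r ≤ x then u else 1) = u + ((#B - 1 : ℕ) : R) := by
  have hmin : B.min' hB ∈ B := B.min'_mem hB
  rw [← add_sum_erase B _ hmin, if_pos fun x hx => B.min'_le x hx, ← card_erase_of_mem hmin,
    ← nsmul_one, ← sum_const]
  congr 1
  refine sum_congr rfl fun r hr => if_neg fun h => ?_
  rw [mem_erase] at hr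
  exact hr.1 (le_antisymm (h _ hmin) (B.min'_le r hr.2))

lemma sum_leadWeight_eq_sum_graft {S : Finset V} {a : V} (ha : a ∈ S) :
    ∑ f ∈ forestsOn S, leadWeight u S f
      = ∑ B ∈ S.powerset with a ∈ B, ∑ r ∈ B, (if ∀ x ∈ B, r ≤ x then u else 1)
        * ((∑ p ∈ forestsOn (B.erase r), leadWeight u (B.erase r) p)
          * ∑ q ∈ forestsOn (S \ B), leadWeight u (S \ B) q) := by
  simp only [sum_mul_sum, ← sum_product']
  simp only [mul_sum, sum_sigma']
  symm
  refine sum_bij (fun t _ => graft t.1 t.2.1 t.2.2.1 t.2.2.2) ?_ ?_ ?_ ?_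
  · rintro ⟨B, r, p, q⟩ h
    simp only [mem_sigma, mem_filter, mem_powerset, mem_product] at h
    exact graft_mem_forestsOn h.1.1 h.2.1 h.2.2.1 h.2.2.2
  · rintro ⟨B, r, p, q⟩ h ⟨B', r', p', q'⟩ h' heq
    simp only [mem_sigma, mem_filter, mem_powerset, mem_product] at h h'
    obtain ⟨rfl, rfl, rfl, rfl⟩ := graft_injective h.1.2 h'.1.2 h.2.1 h'.2.1 h.2.2.1 h'.2.2.1
      h.2.2.2 h'.2.2.2 heq
    rfl
  · intro f hf
    obtain ⟨B, hB, haB, r, hr, p, hp, q, hq, h⟩ := exists_graft_eq hf ha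
    refine ⟨⟨B, r, p, q⟩, ?_, h⟩
    simp only [mem_sigma, mem_filter, mem_powerset, mem_product]
    exact ⟨⟨hB, haB⟩, hr, hp, hq⟩
  · rintro ⟨B, r, p, q⟩ h
    simp only [mem_sigma, mem_filter, mem_powerset, mem_product] at h
    exact (leadWeight_graft u h.1.1 h.2.1 h.2.2.1 h.2.2.2).symm

/-- The leader enumerator of the forests with vertex set `S`. -/
lemma sum_leadWeight (S : Finset V) :
    ∑ f ∈ forestsOn S, leadWeight u S f = hagenProd u (1 - u) (#S) u := by
  induction hn : #S using Nat.strong_induction_on generalizing S with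
  | _ n ih =>
    cases n with
    | zero =>
      obtain rfl := card_eq_zero.1 hn
      have : forestsOn (∅ : Finset V) = {fun _ => none} := by
        ext f
        rw [mem_forestsOn, mem_singleton]
        constructor
        · rintro ⟨-, h⟩
          funext x
          exact Option.eq_none_iff_forall_ne_some.2 fun y hy => by simpa using (h x y hy).1
        · rintro rfl
          refine ⟨fun v hv => ?_, by simp⟩
          obtain ⟨c, hc, -⟩ := TransGen.head'_iff.1 hv
          simp [ParentStep] at hc
      simp [this, leadWeight, hagenProd]
    | succ n =>
      obtain ⟨a, ha⟩ : S.Nonempty := card_pos.1 (by omega)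
      rw [sum_leadWeight_eq_sum_graft u ha, ← hagenProd_recurrence]
      have h := sum_powerset_filter_mem ha (fun k => (u + ((k - 1 : ℕ) : R)) *
        (hagenProd u (1 - u) (k - 1) u * hagenProd u (1 - u) (n + 1 - k) u))
      rw [hn] at h
      refine Eq.trans (sum_congr rfl fun B hB => ?_) (h.trans (sum_congr rfl fun j _ => ?_))
      · obtain ⟨hBS, haB⟩ := by simpa using hB
        have hpos : 0 < #B := card_pos.2 ⟨a, haB⟩
        have hle := card_le_card hBS
        rw [← sum_ite_isLeast u ⟨a, haB⟩, sum_mul]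
        refine sum_congr rfl fun r hr => ?_
        rw [ih (#B - 1) (by omega) (B.erase r) (card_erase_of_mem hr),
          ih (n + 1 - #B) (by omega) (S \ B) (by rw [card_sdiff_of_subset hBS, hn])]
      · rw [nsmul_eq_mul]
        simp only [Nat.add_sub_cancel, Nat.add_sub_add_right]
        ring

end Leaders

end ParentFunctions

lemma forestInvAt_eq_zero_iff {n : ℕ} (F : Forest n) (v : Fin n) :
    forestInvAt F v = 0 ↔ IsLeader F.1 v := by
  rw [forestInvAt, Set.ncard_eq_zero (Set.toFinite _), Set.eq_empty_iff_forall_notMem]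
  refine forall_congr' fun x => ?_
  change ¬(x < v ∧ ReflTransGen (ParentStep F.1) x v) ↔ _
  rw [not_and', not_lt]

lemma pow_forestLead {n : ℕ} {R : Type*} [CommRing R] (u : R) (F : Forest n) :
    u ^ forestLead F = leadWeight u univ F.1 := by
  classical
  simp only [forestLead, forestInvAt_eq_zero_iff, leadWeight]
  rw [prod_ite, prod_const, prod_const_one, mul_one, Set.ncard_eq_toFinset_card']
  congr 2
  ext v
  simp

/-- Seo–Shin formula:
`Σ_{F ∈ F_n} u^{lead F} = u · Π_{i=1}^{n-1} (i + (n-i+1)·u)`. -/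
theorem sum_lead_eq_prod (n : ℕ) (hn : 1 ≤ n) (R : Type*) [CommRing R] (u : R) :
    ∑ F : Forest n, u ^ forestLead F
      = u * ∏ i ∈ Finset.Icc 1 (n - 1), ((i : R) + ((n - i + 1 : ℕ) : R) * u) := by
  obtain ⟨m, rfl⟩ : ∃ m, n = m + 1 := ⟨n - 1, by omega⟩
  have h := sum_leadWeight u (univ : Finset (Fin (m + 1)))
  rw [card_univ, Fintype.card_fin, hagenProd_eq_mul_prod] at h
  rw [Nat.add_sub_cancel, ← h]
  simp only [pow_forestLead]
  exact sum_bij (fun F _ => F.1) (fun F _ => mem_forestsOn.2 ⟨F.2, by simp⟩)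
    (fun F _ F' _ h => Subtype.ext h) (fun f hf => ⟨⟨f, (mem_forestsOn.1 hf).1⟩, mem_univ _, rfl⟩)
    (fun _ _ => rfl)
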